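/- Let β > 3 and let V : ℝ³ → ℂ be measurable with |V(x)| ≤ C₀ ⟨x⟩^{-β} for all x. Suppose ψ : ℝ³ → ℂ is measurable, ∫_{ℝ³} |ψ(x)|² ⟨x⟩^{2σ} dx < ∞ for some σ ≥ −5/2, and ψ(x) = −(4π)^{-1} ∫_{ℝ³} V(y) ψ(y) / |x − y| dy for almost every x ∈ ℝ³. Then for every α < −1/2 one has ∫_{ℝ³} |ψ(x)|² ⟨x⟩^{2α} dx < ∞. -/

import Mathlib

open MeasureTheory

noncomputable section

abbrev E3 : Type := EuclideanSpace ℝ (Fin 3)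

/-- The Japanese bracket `⟨x⟩ = (1 + |x|²)^{1/2}`. -/
def jap (x : E3) : ℝ := Real.sqrt (1 + ‖x‖ ^ 2)

open scoped ENNReal

/-- Weight in `ℝ≥0∞`. -/
def japE (s : ℝ) (x : E3) : ℝ≥0∞ := ENNReal.ofReal (jap x ^ s)

/-- Kernel `1/|z|` in `ℝ≥0∞` (zero at the origin). -/
def kerE (z : E3) : ℝ≥0∞ := ENNReal.ofReal (‖z‖⁻¹)

lemma one_le_jap (x : E3) : 1 ≤ jap x := by
  unfold jap
  rw [Real.one_le_sqrt]
  nlinarith [sq_nonneg ‖x‖]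

lemma jap_pos (x : E3) : 0 < jap x := lt_of_lt_of_le one_pos (one_le_jap x)

lemma jap_sq (x : E3) : jap x ^ 2 = 1 + ‖x‖ ^ 2 := by
  unfold jap
  rw [Real.sq_sqrt (by positivity)]

lemma measurable_jap : Measurable jap := by
  unfold jap
  fun_prop

lemma measurable_japE (s : ℝ) : Measurable (japE s) := by
  unfold japE
  exact (measurable_jap.pow_const s).ennreal_ofReal

lemma measurable_kerE : Measurable kerE := by
  unfold kerE
  fun_prop

lemma japE_mul (s t : ℝ) (x : E3) : japE s x * japE t x = japE (s + t) x := by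
  unfold japE
  rw [← ENNReal.ofReal_mul (Real.rpow_nonneg (jap_pos x).le _), Real.rpow_add (jap_pos x)]

lemma japE_mono {s t : ℝ} (h : s ≤ t) (x : E3) : japE s x ≤ japE t x :=
  ENNReal.ofReal_le_ofReal (Real.rpow_le_rpow_of_exponent_le (one_le_jap x) h)

lemma lintegral_japE_lt_top {r : ℝ} (hr : 3 < r) : ∫⁻ x, japE (-r) x < ⊤ := by
  have h := integrable_rpow_neg_one_add_norm_sq (E := E3) (μ := volume) (r := r)
    (by simpa using hr)
  have h2 := h.lintegral_lt_top
  refine lt_of_eq_of_lt (lintegral_congr fun x => ?_) h2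
  unfold japE jap
  rw [Real.sqrt_eq_rpow, ← Real.rpow_mul (by positivity)]
  congr 2
  ring

lemma lintegral_ker_ball_lt_top :
    ∫⁻ z, (Metric.ball (0 : E3) 1).indicator (fun z => kerE z ^ 2) z < ⊤ := by
  rw [lintegral_indicator measurableSet_ball]
  have h : IntegrableOn (fun z : E3 => (‖z‖⁻¹) ^ 2) (Metric.ball 0 1) volume := by
    refine integrableOn_ball_of_norm_le_rpow (C := 1) (α := 2) (by simp)
      (by rw [finrank_euclideanSpace_fin]; norm_num)
      (Filter.Eventually.of_forall fun x => ?_)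
      (Measurable.aestronglyMeasurable (by fun_prop))
    rw [Real.norm_of_nonneg (by positivity), Real.rpow_neg (norm_nonneg _), one_mul]
    simp
  refine lt_of_eq_of_lt (lintegral_congr fun x => ?_) h.lintegral_lt_top
  unfold kerE
  rw [ENNReal.ofReal_pow (by positivity)]

lemma pointwise_bound {γ : ℝ} (hγ : 0 ≤ γ) (y z : E3) :
    japE (-γ) y * kerE z ^ 2 ≤ (Metric.ball (0 : E3) 1).indicator (fun z => kerE z ^ 2) z +
      2 * (japE (-(γ + 2)) y + japE (-(γ + 2)) z) := by
  by_cases hz : z ∈ Metric.ball (0 : E3) 1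
  · rw [Set.indicator_of_mem hz]
    refine le_trans ?_ le_self_add
    have : japE (-γ) y ≤ 1 := by
      unfold japE
      rw [ENNReal.ofReal_le_one]
      exact Real.rpow_le_one_of_one_le_of_nonpos (one_le_jap y) (by linarith)
    exact mul_le_of_le_one_left zero_le this
  · rw [Set.indicator_of_notMem hz, zero_add]
    have hz1 : 1 ≤ ‖z‖ := by simpa using hz
    have hk : kerE z ^ 2 ≤ 2 * japE (-2) z := by
      unfold kerE japE
      have h2 : (2 : ℝ≥0∞) = ENNReal.ofReal 2 := by simp
      refine le_of_le_of_eq ?_ (congrArg (· * ENNReal.ofReal (jap z ^ (-2 : ℝ))) h2.symm)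
      show _ ≤ ENNReal.ofReal 2 * _
      rw [← ENNReal.ofReal_pow (by positivity), ← ENNReal.ofReal_mul (by norm_num)]
      apply ENNReal.ofReal_le_ofReal
      rw [Real.rpow_neg (jap_pos z).le, Real.rpow_two, jap_sq, inv_pow, ← div_eq_mul_inv,
        inv_eq_one_div, div_le_div_iff₀ (by positivity) (by positivity)]
      nlinarith
    calc japE (-γ) y * kerE z ^ 2 ≤ japE (-γ) y * (2 * japE (-2) z) := by gcongr
      _ = 2 * (japE (-γ) y * japE (-2) z) := by ring
      _ ≤ _ := by
        gcongr
        rw [show -(γ + 2) = -γ + -2 by ring, ← japE_mul, ← japE_mul]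
        rcases le_total (jap y) (jap z) with h | h
        · refine le_trans ?_ le_self_add
          gcongr
          exact ENNReal.ofReal_le_ofReal
            (Real.rpow_le_rpow_of_nonpos (jap_pos y) h (by norm_num))
        · refine le_trans ?_ le_add_self
          gcongr
          exact ENNReal.ofReal_le_ofReal
            (Real.rpow_le_rpow_of_nonpos (jap_pos z) h (by linarith))

lemma kerE_sub_comm (x y : E3) : kerE (x - y) = kerE (y - x) := by
  unfold kerE
  rw [norm_sub_rev]

lemma key_bound {γ : ℝ} (hγ : 1 < γ) :
    ∃ L : ℝ≥0∞, L < ⊤ ∧ ∀ x : E3, ∫⁻ y, japE (-γ) y * kerE (x - y) ^ 2 ≤ L := by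
  refine ⟨(∫⁻ z, (Metric.ball (0 : E3) 1).indicator (fun z => kerE z ^ 2) z) +
    2 * ((∫⁻ y, japE (-(γ + 2)) y) + ∫⁻ y, japE (-(γ + 2)) y), ?_, fun x => ?_⟩
  · have := lintegral_japE_lt_top (r := γ + 2) (by linarith)
    have := lintegral_ker_ball_lt_top
    finiteness
  · have hm := measurable_japE (-(γ + 2))
    have hm2 : Measurable fun y => japE (-(γ + 2)) (x - y) :=
      hm.comp (measurable_const.sub measurable_id)
    have hi : Measurable ((Metric.ball (0 : E3) 1).indicator (fun z => kerE z ^ 2)) :=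
      (measurable_kerE.pow_const 2).indicator measurableSet_ball
    have hi2 : Measurable fun y =>
        ((Metric.ball (0 : E3) 1).indicator (fun z => kerE z ^ 2)) (x - y) :=
      hi.comp (measurable_const.sub measurable_id)
    refine (lintegral_mono fun y => pointwise_bound (by linarith) y (x - y)).trans ?_
    rw [lintegral_add_left hi2, lintegral_const_mul' _ _ (by norm_num), lintegral_add_left hm,
      lintegral_sub_left_eq_self (fun z => japE (-(γ + 2)) z) x,
      lintegral_sub_left_eq_self
        (fun z => (Metric.ball (0 : E3) 1).indicator (fun z => kerE z ^ 2) z) x]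

lemma cauchy_sq {f g : E3 → ℝ≥0∞} (hf : Measurable f) (hg : Measurable g) :
    (∫⁻ y, f y * g y) ^ 2 ≤ (∫⁻ y, f y ^ 2) * ∫⁻ y, g y ^ 2 := by
  have h := ENNReal.lintegral_mul_le_Lp_mul_Lq volume Real.HolderConjugate.two_two
    hf.aemeasurable hg.aemeasurable
  simp only [Pi.mul_apply, ENNReal.rpow_two] at h
  calc _ ≤ _ := pow_le_pow_left' h 2
    _ = _ := by
      rw [mul_pow, ← ENNReal.rpow_two, ← ENNReal.rpow_two, ← ENNReal.rpow_mul,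
        ← ENNReal.rpow_mul]
      norm_num

theorem stmt_16 (β : ℝ) (hβ : 3 < β) (V : E3 → ℂ) (hVm : Measurable V)
    (C0 : ℝ) (hV : ∀ x : E3, ‖V x‖ ≤ C0 * jap x ^ (-β))
    (ψ : E3 → ℂ) (hψm : Measurable ψ) (σ : ℝ) (hσ : -(5 / 2 : ℝ) ≤ σ)
    (hψL2 : (∫⁻ x : E3, ENNReal.ofReal (‖ψ x‖ ^ 2 * jap x ^ (2 * σ))) < ⊤)
    (heq : ∀ᵐ x : E3 ∂(volume : Measure E3),
      ψ x = ((-(1 / (4 * Real.pi)) : ℝ) : ℂ) *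
        ∫ y : E3, V y * ψ y / ((‖x - y‖ : ℝ) : ℂ)) :
    ∀ α : ℝ, α < -(1 / 2 : ℝ) →
      (∫⁻ x : E3, ENNReal.ofReal (‖ψ x‖ ^ 2 * jap x ^ (2 * α))) < ⊤ := by
  intro α hα
  have hrew : ∀ s : ℝ, ∀ x, ENNReal.ofReal (‖ψ x‖ ^ 2 * jap x ^ s) = ‖ψ x‖ₑ ^ 2 * japE s x := by
    intro s x
    rw [ENNReal.ofReal_mul (by positivity), ENNReal.ofReal_pow (norm_nonneg _), ofReal_norm]
    rfl
  simp only [hrew] at hψL2 ⊢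
  have hum : Measurable fun x => ‖ψ x‖ₑ := hψm.enorm
  have hker : ∀ x, Measurable fun y => kerE (x - y) := fun x =>
    measurable_kerE.comp (measurable_const.sub measurable_id)
  -- basic inequality
  obtain ⟨K, hK, hu⟩ : ∃ K : ℝ≥0∞, K < ⊤ ∧ ∀ᵐ x : E3,
      ‖ψ x‖ₑ ≤ K * ∫⁻ y, japE (-β) y * ‖ψ y‖ₑ * kerE (x - y) := by
    refine ⟨‖((-(1 / (4 * Real.pi)) : ℝ) : ℂ)‖ₑ * ENNReal.ofReal C0, by finiteness, ?_⟩
    filter_upwards [heq] with x hx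
    have hm : Measurable fun y => japE (-β) y * ‖ψ y‖ₑ * kerE (x - y) :=
      ((measurable_japE _).mul hum).mul (hker x)
    conv_lhs => rw [hx]
    rw [enorm_mul, mul_assoc, ← lintegral_const_mul _ hm]
    gcongr
    refine (enorm_integral_le_lintegral_enorm _).trans (lintegral_mono fun y => ?_)
    have h1 : ‖V y‖ₑ ≤ ENNReal.ofReal C0 * japE (-β) y := by
      rw [← ofReal_norm, japE, ← ENNReal.ofReal_mul' (Real.rpow_nonneg (jap_pos y).le _)]
      exact ENNReal.ofReal_le_ofReal (hV y)
    have h2 : ‖(((‖x - y‖ : ℝ) : ℂ))⁻¹‖ₑ = kerE (x - y) := by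
      rw [← ofReal_norm, kerE, norm_inv, Complex.norm_real, norm_norm]
    show ‖V y * ψ y / ((‖x - y‖ : ℝ) : ℂ)‖ₑ ≤ _
    rw [div_eq_mul_inv, enorm_mul, enorm_mul, h2, ← mul_assoc, ← mul_assoc]
    gcongr
  -- step 1: boundedness
  obtain ⟨L, hL, hLb⟩ := key_bound (γ := 2 * β - 5) (by linarith)
  set A := ∫⁻ y, ‖ψ y‖ₑ ^ 2 * japE (2 * σ) y with hA
  have hbd : ∀ᵐ x : E3, ‖ψ x‖ₑ ^ 2 ≤ K ^ 2 * (L * A) := by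
    filter_upwards [hu] with x hx
    refine (pow_le_pow_left' hx 2).trans ?_
    rw [mul_pow]
    gcongr
    have hc := cauchy_sq (f := fun y => japE (-β + 5 / 2) y * kerE (x - y))
      (g := fun y => ‖ψ y‖ₑ * japE (-(5 / 2)) y)
      ((measurable_japE _).mul (hker x)) (hum.mul (measurable_japE _))
    have e1 : ∀ y, japE (-β) y * ‖ψ y‖ₑ * kerE (x - y) =
        (japE (-β + 5 / 2) y * kerE (x - y)) * (‖ψ y‖ₑ * japE (-(5 / 2)) y) := by
      intro y
      rw [show -β = (-β + 5 / 2) + -(5 / 2) by ring, ← japE_mul]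
      ring_nf
    simp only [e1]
    refine hc.trans ?_
    gcongr
    · refine le_trans (le_of_eq (lintegral_congr fun y => ?_)) (hLb x)
      rw [mul_pow, sq (japE _ y), japE_mul]
      congr 2
      ring
    · refine lintegral_mono fun y => ?_
      show (‖ψ y‖ₑ * japE (-(5 / 2)) y) ^ 2 ≤ ‖ψ y‖ₑ ^ 2 * japE (2 * σ) y
      rw [mul_pow, sq (japE _ _), japE_mul]
      gcongr
      exact japE_mono (by linarith) _
  -- step 2
  set M2 := K ^ 2 * (L * A) with hM2
  have hM2t : M2 < ⊤ := by finiteness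
  obtain ⟨L', hL', hLb'⟩ := key_bound (γ := -(2 * α)) (by linarith)
  have hB := lintegral_japE_lt_top hβ
  set B := ∫⁻ y, japE (-β) y with hBdef
  have hbd2 : ∀ᵐ x : E3, ‖ψ x‖ₑ ^ 2 ≤
      (K ^ 2 * (B * M2)) * ∫⁻ y, japE (-β) y * kerE (x - y) ^ 2 := by
    filter_upwards [hu] with x hx
    have hm : Measurable fun y => japE (-β) y * kerE (x - y) ^ 2 :=
      (measurable_japE _).mul ((hker x).pow_const 2)
    refine (pow_le_pow_left' hx 2).trans ?_
    rw [mul_pow, mul_assoc]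
    gcongr
    have hc := cauchy_sq (f := fun y => japE (-(β / 2)) y * ‖ψ y‖ₑ)
      (g := fun y => japE (-(β / 2)) y * kerE (x - y))
      ((measurable_japE _).mul hum) ((measurable_japE _).mul (hker x))
    have e0 : ∀ y, japE (-(β / 2)) y ^ 2 = japE (-β) y := by
      intro y
      rw [sq, japE_mul]
      congr 1
      ring
    have e1 : ∀ y, japE (-β) y * ‖ψ y‖ₑ * kerE (x - y) =
        (japE (-(β / 2)) y * ‖ψ y‖ₑ) * (japE (-(β / 2)) y * kerE (x - y)) := by
      intro y
      rw [← e0]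
      ring
    simp only [e1]
    refine hc.trans ?_
    simp only [mul_pow, e0]
    gcongr
    rw [← lintegral_mul_const _ (measurable_japE _)]
    refine lintegral_mono_ae ?_
    filter_upwards [hbd] with y hy
    gcongr
  have hm2 : Measurable (Function.uncurry fun x y : E3 =>
      japE (-β) y * kerE (x - y) ^ 2 * japE (2 * α) x) :=
    (((measurable_japE _).comp measurable_snd).mul
      ((measurable_kerE.comp (measurable_fst.sub measurable_snd)).pow_const 2)).mul
      ((measurable_japE _).comp measurable_fst)
  have hmi : ∀ x, Measurable fun y => japE (-β) y * kerE (x - y) ^ 2 := fun x =>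
    (measurable_japE _).mul ((hker x).pow_const 2)
  have hc : K ^ 2 * (B * M2) ≠ ⊤ := by finiteness
  calc ∫⁻ x, ‖ψ x‖ₑ ^ 2 * japE (2 * α) x
      ≤ ∫⁻ x, (K ^ 2 * (B * M2)) *
          ∫⁻ y, japE (-β) y * kerE (x - y) ^ 2 * japE (2 * α) x := by
        refine lintegral_mono_ae ?_
        filter_upwards [hbd2] with x hx
        rw [lintegral_mul_const _ (hmi x), ← mul_assoc]
        gcongr
    _ = (K ^ 2 * (B * M2)) *
          ∫⁻ x, ∫⁻ y, japE (-β) y * kerE (x - y) ^ 2 * japE (2 * α) x :=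
        lintegral_const_mul' _ _ hc
    _ = (K ^ 2 * (B * M2)) *
          ∫⁻ y, ∫⁻ x, japE (-β) y * kerE (x - y) ^ 2 * japE (2 * α) x := by
        rw [lintegral_lintegral_swap hm2.aemeasurable]
    _ ≤ (K ^ 2 * (B * M2)) * ∫⁻ y, japE (-β) y * L' := by
        gcongr with y
        have e : ∀ x, japE (-β) y * kerE (x - y) ^ 2 * japE (2 * α) x =
            japE (-β) y * (japE (-(-(2 * α))) x * kerE (y - x) ^ 2) := by
          intro x
          rw [neg_neg, kerE_sub_comm x y]
          ring
        simp only [e]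
        rw [lintegral_const_mul' _ _ (show japE (-β) y ≠ ⊤ from ENNReal.ofReal_ne_top)]
        gcongr
        exact hLb' y
    _ = (K ^ 2 * (B * M2)) * (B * L') := by
        rw [lintegral_mul_const _ (measurable_japE _)]
    _ < ⊤ := by finiteness
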